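/- Let K be a differential field of characteristic zero and K{r} the differential polynomial ring in one differential indeterminate r. Let a, b ∈ K{r} with b ≠ 0 and with at least one of a, b not in K, and set d = max(ord(a), ord(b)). If, in the fraction field of K{r}, the element a/b does not lie in the subfield K(r^{(0)}, r^{(1)}, …, r^{(d−1)}) generated by K and the derivatives of r of order strictly less than d, then a'b − ab' ∉ K and ord(a'b − ab') = d + 1. -/

import Mathlib

open MvPolynomial

theorem wr_natDegree_eq {A : Type*} [CommRing A] [IsDomain A] [CharZero A]
    (p q : Polynomial A) (hp : p ≠ 0) (hq : q ≠ 0)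
    (h : Polynomial.derivative p * q = p * Polynomial.derivative q) :
    p.natDegree = q.natDegree := by
  have key : ∀ u v : Polynomial A, u ≠ 0 → v ≠ 0 →
      (Polynomial.X * Polynomial.derivative u * v).coeff (u.natDegree + v.natDegree)
        = u.natDegree * (u.leadingCoeff * v.leadingCoeff) := by
    intro u v _ _
    have h1 : (Polynomial.X * Polynomial.derivative u).natDegree ≤ u.natDegree := by
      rw [Polynomial.natDegree_le_iff_coeff_eq_zero]
      intro N hN
      obtain ⟨M, rfl⟩ : ∃ M, N = M + 1 := ⟨N - 1, by omega⟩
      rw [Polynomial.coeff_X_mul, Polynomial.coeff_derivative,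
        Polynomial.coeff_eq_zero_of_natDegree_lt hN, zero_mul]
    rw [Polynomial.coeff_mul_add_eq_of_natDegree_le h1 le_rfl]
    rcases Nat.eq_zero_or_pos u.natDegree with h0 | h0
    · rw [h0]; simp
    · obtain ⟨M, hM⟩ : ∃ M, u.natDegree = M + 1 := ⟨u.natDegree - 1, by omega⟩
      simp only [Polynomial.leadingCoeff]
      rw [hM, Polynomial.coeff_X_mul, Polynomial.coeff_derivative]
      push_cast
      ring
  have e1 := key p q hp hq
  have e2 := key q p hq hp
  have e3 : Polynomial.X * Polynomial.derivative q * p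
      = Polynomial.X * Polynomial.derivative p * q := by
    linear_combination (-Polynomial.X) * h
  rw [e3, add_comm, e1] at e2
  have hne : p.leadingCoeff * q.leadingCoeff ≠ 0 :=
    mul_ne_zero (Polynomial.leadingCoeff_ne_zero.2 hp) (Polynomial.leadingCoeff_ne_zero.2 hq)
  rw [mul_comm q.leadingCoeff] at e2
  exact_mod_cast mul_right_cancel₀ hne e2

theorem wr_proportional {A : Type*} [CommRing A] [IsDomain A] [CharZero A]
    (p q : Polynomial A) (hq : q ≠ 0)
    (h : Polynomial.derivative p * q = p * Polynomial.derivative q) :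
    Polynomial.C q.leadingCoeff * p = Polynomial.C p.leadingCoeff * q := by
  by_cases hp : p = 0
  · simp [hp]
  have hd := wr_natDegree_eq p q hp hq h
  by_contra hne
  have hr : Polynomial.C q.leadingCoeff * p - Polynomial.C p.leadingCoeff * q ≠ 0 :=
    sub_ne_zero.2 hne
  have hdr := wr_natDegree_eq _ q hr hq (by
    simp only [Polynomial.derivative_sub, Polynomial.derivative_mul, Polynomial.derivative_C]
    linear_combination Polynomial.C q.leadingCoeff * h)
  apply hr
  rw [← Polynomial.leadingCoeff_eq_zero, Polynomial.leadingCoeff, hdr, Polynomial.coeff_sub,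
    Polynomial.coeff_C_mul, Polynomial.coeff_C_mul]
  nth_rewrite 2 [← hd]
  simp only [Polynomial.leadingCoeff, hd]
  ring

/-- Singling out the variable `d`. -/
noncomputable def wrPhi (K : Type*) [Field K] (d : ℕ) :
    MvPolynomial ℕ K →ₐ[K] Polynomial (MvPolynomial ℕ K) :=
  aeval (fun i => if i = d then Polynomial.X else Polynomial.C (X i))

theorem wrPhi_eval {K : Type*} [Field K] (d : ℕ) (p : MvPolynomial ℕ K) :
    (wrPhi K d p).eval (X d) = p := by
  induction p using MvPolynomial.induction_on with
  | C c =>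
    simp [wrPhi, aeval_C, Polynomial.algebraMap_apply, MvPolynomial.algebraMap_eq]
  | add p q hp hq => simp [hp, hq]
  | mul_X p i hp =>
    rw [map_mul, Polynomial.eval_mul, hp]
    simp only [wrPhi, aeval_X]
    split_ifs with h <;> simp [h]

theorem wrPhi_deriv {K : Type*} [Field K] (d : ℕ) (p : MvPolynomial ℕ K) :
    wrPhi K d (pderiv d p) = Polynomial.derivative (wrPhi K d p) := by
  induction p using MvPolynomial.induction_on with
  | C c =>
    simp [wrPhi, aeval_C, Polynomial.algebraMap_apply, MvPolynomial.algebraMap_eq]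
  | add p q hp hq => simp [hp, hq]
  | mul_X p i hp =>
    rw [Derivation.leibniz, map_mul, Polynomial.derivative_mul, ← hp, map_add,
      smul_eq_mul, smul_eq_mul, map_mul, map_mul]
    have : wrPhi K d (pderiv d (X i)) = Polynomial.derivative (wrPhi K d (X i)) := by
      by_cases h : i = d
      · subst h; simp [wrPhi]
      · rw [pderiv_X_of_ne h]; simp [wrPhi, h]
    rw [this]
    ring

theorem wrPhi_coeff {K : Type*} [Field K] (d : ℕ) (p : MvPolynomial ℕ K)
    (hp : p ∈ supported K (Set.Iic d)) (n : ℕ) :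
    (wrPhi K d p).coeff n ∈ supported K (Set.Iio d) := by
  rw [supported_eq_adjoin_X] at hp
  induction hp using Algebra.adjoin_induction generalizing n with
  | mem x hx =>
    obtain ⟨i, hi, rfl⟩ := hx
    simp only [wrPhi, aeval_X]
    split_ifs with h
    · rw [Polynomial.coeff_X]
      split_ifs
      · exact one_mem _
      · exact zero_mem _
    · rw [Polynomial.coeff_C]
      split_ifs
      · exact (X_mem_supported).2 (lt_of_le_of_ne hi h)
      · exact zero_mem _
  | algebraMap r =>
    rw [AlgHom.commutes, Polynomial.algebraMap_apply, Polynomial.coeff_C]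
    split_ifs
    · exact Subalgebra.algebraMap_mem _ r
    · exact zero_mem _
  | add x y _ _ hx hy =>
    rw [map_add, Polynomial.coeff_add]
    exact add_mem (hx n) (hy n)
  | mul x y _ _ hx hy =>
    rw [map_mul, Polynomial.coeff_mul]
    exact sum_mem fun i _ => mul_mem (hx _) (hy _)

theorem wr_pderiv_supported {K : Type*} [Field K] (d : ℕ) (s : Set ℕ) (p : MvPolynomial ℕ K)
    (hp : p ∈ supported K s) : pderiv d p ∈ supported K s := by
  rw [supported_eq_adjoin_X] at hp
  induction hp using Algebra.adjoin_induction with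
  | mem x hx =>
    obtain ⟨i, hi, rfl⟩ := hx
    by_cases h : i = d
    · subst h; rw [pderiv_X_self]; exact one_mem _
    · rw [pderiv_X_of_ne h]; exact zero_mem _
  | algebraMap r => rw [Derivation.map_algebraMap]; exact zero_mem _
  | add x y _ _ hx hy => rw [map_add]; exact add_mem hx hy
  | mul x y hx' hy' hx hy =>
    rw [← supported_eq_adjoin_X] at hx' hy'
    rw [Derivation.leibniz]
    exact add_mem (mul_mem hx' hy) (mul_mem hy' hx)

theorem wr_D {K : Type*} [Field K] (dK : K → K)
    (D : MvPolynomial ℕ K → MvPolynomial ℕ K)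
    (hD_add : ∀ p q, D (p + q) = D p + D q)
    (hD_mul : ∀ p q, D (p * q) = p * D q + D p * q)
    (hD_C : ∀ c : K, D (MvPolynomial.C c) = MvPolynomial.C (dK c))
    (hD_X : ∀ j : ℕ, D (X j) = X (j + 1)) (d : ℕ) (p : MvPolynomial ℕ K)
    (hp : p ∈ supported K (Set.Iic d)) :
    D p - pderiv d p * X (d + 1) ∈ supported K (Set.Iic d) := by
  rw [supported_eq_adjoin_X] at hp
  induction hp using Algebra.adjoin_induction with
  | mem x hx =>
    obtain ⟨i, hi, rfl⟩ := hx
    rw [hD_X]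
    by_cases h : i = d
    · subst h; rw [pderiv_X_self, one_mul, sub_self]; exact zero_mem _
    · rw [pderiv_X_of_ne h, zero_mul, sub_zero]
      exact X_mem_supported.2 (lt_of_le_of_ne hi h)
  | algebraMap r =>
    rw [Derivation.map_algebraMap, zero_mul, sub_zero, MvPolynomial.algebraMap_eq, hD_C]
    exact Subalgebra.algebraMap_mem _ _
  | add x y _ _ hx hy =>
    rw [map_add, hD_add]
    convert add_mem hx hy using 1
    ring
  | mul x y hx' hy' hx hy =>
    rw [← supported_eq_adjoin_X] at hx' hy'
    rw [Derivation.leibniz, hD_mul, smul_eq_mul, smul_eq_mul]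
    convert add_mem (mul_mem hx' hy) (mul_mem hy' hx) using 1
    ring

/-- **Order of the Wronskian-type combination `a'b − ab'` (Lemma 7.3).**
Let `K` be a differential field of characteristic zero with derivation `dK` and let
`K{r}` be the differential polynomial ring in one differential indeterminate `r`, modelled
as `MvPolynomial ℕ K` with `X j` playing the role of `r^{(j)}` and `D` the unique derivation
extending `dK` with `r^{(j)} ↦ r^{(j+1)}`.  For nonconstant `h` the order `ord h` is the
largest `j` such that `r^{(j)}` occurs in `h`, i.e. `h.vars.sup id`.  Let `a, b ∈ K{r}` with
`b ≠ 0`, at least one of `a, b` not in `K`, and set `d = max (ord a) (ord b)`.  If, in the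
fraction field of `K{r}`, `a/b` does not lie in the subfield `K(r^{(0)},…,r^{(d−1)})`, then
`a'b − ab' ∉ K` and `ord (a'b − ab') = d + 1`. -/
theorem order_of_wronskian_combination
    {K : Type*} [Field K] [CharZero K] (dK : K → K)
    (hdK_add : ∀ a b : K, dK (a + b) = dK a + dK b)
    (hdK_mul : ∀ a b : K, dK (a * b) = a * dK b + dK a * b)
    (D : MvPolynomial ℕ K → MvPolynomial ℕ K)
    (hD_add : ∀ p q, D (p + q) = D p + D q)
    (hD_mul : ∀ p q, D (p * q) = p * D q + D p * q)
    (hD_C : ∀ c : K, D (MvPolynomial.C c) = MvPolynomial.C (dK c))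
    (hD_X : ∀ j : ℕ, D (X j) = X (j + 1))
    (a b : MvPolynomial ℕ K) (hb : b ≠ 0)
    (hnotK : (¬ ∃ c : K, a = MvPolynomial.C c) ∨ (¬ ∃ c : K, b = MvPolynomial.C c))
    (hfrac : (algebraMap (MvPolynomial ℕ K) (FractionRing (MvPolynomial ℕ K)) a) /
        (algebraMap (MvPolynomial ℕ K) (FractionRing (MvPolynomial ℕ K)) b) ∉
      Subfield.closure
        ((Set.range fun c : K =>
            algebraMap (MvPolynomial ℕ K) (FractionRing (MvPolynomial ℕ K))
              (MvPolynomial.C c)) ∪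
          ((fun j : ℕ =>
            algebraMap (MvPolynomial ℕ K) (FractionRing (MvPolynomial ℕ K)) (X j)) ''
            Set.Iio (max (a.vars.sup id) (b.vars.sup id))))) :
    (¬ ∃ c : K, D a * b - a * D b = MvPolynomial.C c) ∧
    (D a * b - a * D b).vars.sup id = max (a.vars.sup id) (b.vars.sup id) + 1 := by
  set d := max (a.vars.sup id) (b.vars.sup id) with hd
  have ha' : a ∈ supported K (Set.Iic d) := by
    rw [mem_supported]
    intro i hi
    exact le_trans (Finset.le_sup (f := id) hi) (le_max_left _ _)
  have hb' : b ∈ supported K (Set.Iic d) := by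
    rw [mem_supported]
    intro i hi
    exact le_trans (Finset.le_sup (f := id) hi) (le_max_right _ _)
  have hW : pderiv d a * b - a * pderiv d b ≠ 0 := by
    intro h0
    apply hfrac
    have hinj : wrPhi K d b ≠ 0 := by
      intro h
      apply hb
      rw [← wrPhi_eval d b, h, Polynomial.eval_zero]
    have hprop := wr_proportional (wrPhi K d a) (wrPhi K d b) hinj (by
      rw [← wrPhi_deriv, ← wrPhi_deriv, ← map_mul, ← map_mul, sub_eq_zero.1 h0])
    have hev := congrArg (Polynomial.eval (X d)) hprop
    rw [Polynomial.eval_mul, Polynomial.eval_mul, Polynomial.eval_C, Polynomial.eval_C,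
      wrPhi_eval, wrPhi_eval] at hev
    have hla : (wrPhi K d a).leadingCoeff ∈ supported K (Set.Iio d) := wrPhi_coeff d a ha' _
    have hlb : (wrPhi K d b).leadingCoeff ∈ supported K (Set.Iio d) := wrPhi_coeff d b hb' _
    have hlb0 : (wrPhi K d b).leadingCoeff ≠ 0 := Polynomial.leadingCoeff_ne_zero.2 hinj
    have hmem : ∀ p ∈ supported K (Set.Iio d),
        algebraMap (MvPolynomial ℕ K) (FractionRing (MvPolynomial ℕ K)) p ∈
        Subfield.closure
        ((Set.range fun c : K =>
            algebraMap (MvPolynomial ℕ K) (FractionRing (MvPolynomial ℕ K))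
              (MvPolynomial.C c)) ∪
          ((fun j : ℕ =>
            algebraMap (MvPolynomial ℕ K) (FractionRing (MvPolynomial ℕ K)) (X j)) ''
            Set.Iio d)) := by
      intro p hp
      rw [supported_eq_adjoin_X] at hp
      induction hp using Algebra.adjoin_induction with
      | mem x hx =>
        obtain ⟨i, hi, rfl⟩ := hx
        exact Subfield.subset_closure (Or.inr ⟨i, hi, rfl⟩)
      | algebraMap r => exact Subfield.subset_closure (Or.inl ⟨r, rfl⟩)
      | add x y _ _ hx hy => rw [map_add]; exact add_mem hx hy
      | mul x y _ _ hx hy => rw [map_mul]; exact mul_mem hx hy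
    have hne : ∀ p : MvPolynomial ℕ K, p ≠ 0 →
        algebraMap (MvPolynomial ℕ K) (FractionRing (MvPolynomial ℕ K)) p ≠ 0 := fun p hp =>
      (map_ne_zero_iff _ (IsFractionRing.injective _ _)).2 hp
    have heq : (algebraMap (MvPolynomial ℕ K) (FractionRing (MvPolynomial ℕ K)) a) /
        (algebraMap (MvPolynomial ℕ K) (FractionRing (MvPolynomial ℕ K)) b) =
        algebraMap (MvPolynomial ℕ K) (FractionRing (MvPolynomial ℕ K))
          (wrPhi K d a).leadingCoeff /
        algebraMap (MvPolynomial ℕ K) (FractionRing (MvPolynomial ℕ K))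
          (wrPhi K d b).leadingCoeff := by
      rw [div_eq_div_iff (hne _ hb) (hne _ hlb0), ← map_mul, ← map_mul, ← hev, mul_comm]
    rw [heq]
    exact div_mem (hmem _ hla) (hmem _ hlb)
  have hDa := wr_D dK D hD_add hD_mul hD_C hD_X d a ha'
  have hDb := wr_D dK D hD_add hD_mul hD_C hD_X d b hb'
  have hWs : pderiv d a * b - a * pderiv d b ∈ supported K (Set.Iic d) :=
    sub_mem (mul_mem (wr_pderiv_supported d _ a ha') hb')
      (mul_mem ha' (wr_pderiv_supported d _ b hb'))
  have hR := sub_mem (mul_mem hDa hb') (mul_mem ha' hDb)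
  set W := pderiv d a * b - a * pderiv d b with hWdef
  obtain ⟨R, hRdef⟩ : ∃ R, R = (D a - pderiv d a * X (d + 1)) * b
    - a * (D b - pderiv d b * X (d + 1)) := ⟨_, rfl⟩
  rw [← hRdef] at hR
  have hE : D a * b - a * D b = W * X (d + 1) + R := by
    rw [hRdef, hWdef]; ring
  have hz : ∀ p ∈ supported K (Set.Iic d), pderiv (d + 1) p = 0 := by
    intro p hp
    apply pderiv_eq_zero_of_notMem_vars
    intro h
    have := mem_supported.1 hp h
    simp at this
  have hpE : pderiv (d + 1) (D a * b - a * D b) = W := by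
    rw [hE, map_add, Derivation.leibniz, hz W hWs, hz R hR, pderiv_X_self]
    simp
  have hEs : D a * b - a * D b ∈ supported K (Set.Iic (d + 1)) := by
    have hmono : supported K (Set.Iic d) ≤ supported K (Set.Iic (d + 1)) :=
      supported_mono (Set.Iic_subset_Iic.2 (Nat.le_succ d))
    rw [hE]
    exact add_mem (mul_mem (hmono hWs) (X_mem_supported.2 (by simp))) (hmono hR)
  constructor
  · rintro ⟨c, hc⟩
    rw [hc, pderiv_C] at hpE
    exact hW hpE.symm
  · apply le_antisymm
    · apply Finset.sup_le
      intro i hi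
      exact mem_supported.1 hEs hi
    · have : d + 1 ∈ (D a * b - a * D b).vars := by
        by_contra h
        exact hW (hpE.symm.trans (pderiv_eq_zero_of_notMem_vars h))
      exact Finset.le_sup (f := id) this
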